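/- arXiv:0810.4039 — 2 statements merged into one kernel-verified Lean document; each statement's English description precedes it below -/
import Mathlib

section
/- Let (K,d) be a differential field of characteristic 0 and let (M,∂) be a differential module over K of dimension 6 with det M = 1. The following are equivalent: (1) M ≅ Λ²N as differential modules for some differential module N over K of dimension 4 with det N = 1; (2) there exists F ∈ Sym²M with ∂F = 0 such that the symmetric bilinear form on M* determined by F is nondegenerate and admits a totally isotropic subspace of dimension 3. -/
open Module

/-- `d` is a derivation on the field `K`. -/
def IsDeriv {K : Type} [Field K] (d : K → K) : Prop :=
  (∀ a b, d (a + b) = d a + d b) ∧ (∀ a b, d (a * b) = d a * b + a * d b)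

/-- `D` is a differential-module structure on `M` over the differential field `(K, d)`. -/
def IsDiff {K : Type} [Field K] (d : K → K) {M : Type} [AddCommGroup M] [Module K M]
    (D : M → M) : Prop :=
  (∀ x y, D (x + y) = D x + D y) ∧ (∀ (a : K) (m : M), D (a • m) = d a • m + a • D m)

/-- `det M = 1`: the matrix of `D` in some basis of `M` has trace `0`. -/
def TraceZero (K : Type) [Field K] {M : Type} [AddCommGroup M] [Module K M]
    (D : M → M) (n : ℕ) : Prop :=
  ∃ (b : Basis (Fin n) K M) (A : Matrix (Fin n) (Fin n) K),
    (∀ i, D (b i) = ∑ j, A j i • b j) ∧ Matrix.trace A = 0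

/-- The induced differential structure on the dual module. -/
def dualD {K : Type} [Field K] {d : K → K} {M : Type} [AddCommGroup M] [Module K M]
    {D : M → M} (hd : IsDeriv d) (hD : IsDiff d D) (φ : Module.Dual K M) :
    Module.Dual K M where
  toFun m := d (φ m) - φ (D m)
  map_add' x y := by
    simp only [map_add, hd.1, hD.1]; ring
  map_smul' a m := by
    simp only [map_smul, hD.2, map_add, smul_eq_mul, hd.2, RingHom.id_apply]; ring

/-- `M` is an irreducible differential module. -/
def IsIrr (K : Type) [Field K] {M : Type} [AddCommGroup M] [Module K M]
    (D : M → M) : Prop :=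
  (∃ m : M, m ≠ 0) ∧ ∀ W : Submodule K M, (∀ x ∈ W, D x ∈ W) → W = ⊥ ∨ W = ⊤

section Helpers
variable {K : Type} [Field K]

theorem dzero_aux {d : K → K} (hd : IsDeriv d) : d 0 = 0 := by
  have := hd.1 0 0; simpa using this

theorem done_aux {d : K → K} (hd : IsDeriv d) : d 1 = 0 := by
  have := hd.2 1 1; simpa using this

theorem dneg_aux {d : K → K} (hd : IsDeriv d) (a : K) : d (-a) = -d a := by
  have := hd.1 a (-a)
  rw [add_neg_cancel, dzero_aux hd] at this
  linear_combination -this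

theorem dsub_aux {d : K → K} (hd : IsDeriv d) (a b : K) : d (a - b) = d a - d b := by
  rw [sub_eq_add_neg, hd.1, dneg_aux hd, sub_eq_add_neg]

variable {M : Type} [AddCommGroup M] [Module K M]

/-- The split form attached to six vectors. -/
def splitForm (m : Fin 6 → M) : Module.Dual K M →ₗ[K] Module.Dual K M →ₗ[K] K :=
  LinearMap.mk₂ K (fun φ ψ => φ (m 0) * ψ (m 5) + φ (m 5) * ψ (m 0)
      + φ (m 1) * ψ (m 4) + φ (m 4) * ψ (m 1) + φ (m 2) * ψ (m 3) + φ (m 3) * ψ (m 2))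
    (by intros; simp only [LinearMap.add_apply]; ring)
    (by intros; simp only [LinearMap.smul_apply, smul_eq_mul]; ring)
    (by intros; simp only [LinearMap.add_apply]; ring)
    (by intros; simp only [LinearMap.smul_apply, smul_eq_mul]; ring)

theorem splitForm_apply (m : Fin 6 → M) (φ ψ : Module.Dual K M) :
    splitForm m φ ψ = φ (m 0) * ψ (m 5) + φ (m 5) * ψ (m 0)
      + φ (m 1) * ψ (m 4) + φ (m 4) * ψ (m 1) + φ (m 2) * ψ (m 3) + φ (m 3) * ψ (m 2) := rfl

/-- The alternating map `K⁴ × K⁴ → M` attached to six vectors. -/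
def wedgeMap (m : Fin 6 → M) : (Fin 4 → K) →ₗ[K] (Fin 4 → K) →ₗ[K] M :=
  LinearMap.mk₂ K (fun x y => (x 0 * y 1 - x 1 * y 0) • m 0 + (x 0 * y 2 - x 2 * y 0) • m 1
      + (x 0 * y 3 - x 3 * y 0) • m 2 + (x 1 * y 2 - x 2 * y 1) • m 3
      + (x 3 * y 1 - x 1 * y 3) • m 4 + (x 2 * y 3 - x 3 * y 2) • m 5)
    (by intros; simp only [Pi.add_apply]; module)
    (by intros; simp only [Pi.smul_apply, smul_eq_mul]; module)
    (by intros; simp only [Pi.add_apply]; module)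
    (by intros; simp only [Pi.smul_apply, smul_eq_mul]; module)

theorem wedgeMap_apply (m : Fin 6 → M) (x y : Fin 4 → K) :
    wedgeMap m x y = (x 0 * y 1 - x 1 * y 0) • m 0 + (x 0 * y 2 - x 2 * y 0) • m 1
      + (x 0 * y 3 - x 3 * y 0) • m 2 + (x 1 * y 2 - x 2 * y 1) • m 3
      + (x 3 * y 1 - x 1 * y 3) • m 4 + (x 2 * y 3 - x 3 * y 2) • m 5 := rfl

theorem forward [CharZero K] (d : K → K) (hd : IsDeriv d) [FiniteDimensional K M]
    (hdim : Module.finrank K M = 6)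
    (D : M → M) (hD : IsDiff d D)
    (DN : (Fin 4 → K) → (Fin 4 → K)) (htr : TraceZero K DN 4)
    (β : (Fin 4 → K) →ₗ[K] (Fin 4 → K) →ₗ[K] M)
    (halt : ∀ x, β x x = 0)
    (hβ : ∀ x y, D (β x y) = β (DN x) y + β x (DN y))
    (hspan : Submodule.span K {m : M | ∃ x y, β x y = m} = ⊤) :
    ∃ B : Module.Dual K M →ₗ[K] Module.Dual K M →ₗ[K] K,
      (∀ φ ψ, B φ ψ = B ψ φ) ∧
      (∀ φ ψ, d (B φ ψ) = B (dualD hd hD φ) ψ + B φ (dualD hd hD ψ)) ∧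
      (∀ φ, (∀ ψ, B φ ψ = 0) → φ = 0) ∧
      ∃ W : Submodule K (Module.Dual K M), Module.finrank K W = 3 ∧
        ∀ φ ∈ W, ∀ ψ ∈ W, B φ ψ = 0 := by
  obtain ⟨b, A, hA, hAtr⟩ := htr
  have hanti : ∀ x y, β x y = - β y x := by
    intro x y
    have h := halt (x + y)
    simp only [map_add, LinearMap.add_apply, halt, zero_add, add_zero] at h
    exact eq_neg_of_add_eq_zero_right h
  set m : Fin 6 → M := ![β (b 0) (b 1), β (b 0) (b 2), β (b 0) (b 3), β (b 1) (b 2),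
    β (b 3) (b 1), β (b 2) (b 3)] with hm
  have e10 := hanti (b 1) (b 0)
  have e20 := hanti (b 2) (b 0)
  have e30 := hanti (b 3) (b 0)
  have e21 := hanti (b 2) (b 1)
  have e13 := hanti (b 1) (b 3)
  have e32 := hanti (b 3) (b 2)
  have hmem : ∀ i, m i ∈ Submodule.span K (Set.range m) := fun i =>
    Submodule.subset_span ⟨i, rfl⟩
  have htop : ⊤ ≤ Submodule.span K (Set.range m) := by
    rw [← hspan, Submodule.span_le]
    rintro _ ⟨x, y, rfl⟩
    have h : β x y = wedgeMap m (b.repr x) (b.repr y) := by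
      conv_lhs => rw [← b.sum_repr x, ← b.sum_repr y]
      rw [wedgeMap_apply]
      simp only [Fin.sum_univ_four, map_add, map_smul, LinearMap.add_apply,
        LinearMap.smul_apply, halt, e10, e20, e30, e21, e13, e32]
      simp only [hm, Matrix.cons_val]
      module
    rw [h, wedgeMap_apply]
    refine SetLike.mem_coe.2 ?_
    refine add_mem (add_mem (add_mem (add_mem (add_mem ?_ ?_) ?_) ?_) ?_) ?_ <;>
      exact Submodule.smul_mem _ _ (hmem _)
  let mb : Basis (Fin 6) K M := basisOfTopLeSpanOfCardEqFinrank m htop (by simp [hdim])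
  have hmb : ∀ i, mb i = m i := fun i => by simp [mb]
  have hc : ∀ i j, mb.coord i (m j) = if j = i then 1 else 0 := by
    intro i j
    rw [← hmb, Basis.coord_apply, Basis.repr_self, Finsupp.single_apply]
  refine ⟨splitForm m, ?_, ?_, ?_, ?_⟩
  · intro φ ψ; simp only [splitForm_apply]; ring
  · intro φ ψ
    rw [Matrix.trace, Fin.sum_univ_four] at hAtr
    simp only [Matrix.diag_apply] at hAtr
    have hdu : ∀ (φ : Module.Dual K M) x, dualD hd hD φ x = d (φ x) - φ (D x) :=
      fun _ _ => rfl
    simp only [splitForm_apply, hd.1, hd.2, hdu]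
    simp only [hm, Matrix.cons_val, hβ, hA, Fin.sum_univ_four, map_add, map_smul,
      LinearMap.add_apply, LinearMap.smul_apply, halt, e10, e20, e30, e21, e13, e32,
      smul_eq_mul, map_neg, smul_zero, map_zero, add_zero, zero_add]
    have h0 : A 0 0 = -(A 1 1 + A 2 2 + A 3 3) := by linear_combination hAtr
    rw [h0]
    ring
  · intro φ hφ
    apply mb.ext
    have h := fun j => hφ (mb.coord j)
    simp only [splitForm_apply, hc] at h
    intro i
    rw [hmb]
    fin_cases i
    · simpa using h 5
    · simpa using h 4
    · simpa using h 3
    · simpa using h 2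
    · simpa using h 1
    · simpa using h 0
  · let v : Fin 3 → Module.Dual K M := fun i => mb.coord (Fin.castLE (by norm_num) i)
    have hv : LinearIndependent K v := by
      have := mb.dualBasis.linearIndependent.comp (Fin.castLE (by norm_num : 3 ≤ 6))
        (Fin.castLE_injective _)
      have hve : v = mb.dualBasis ∘ Fin.castLE (by norm_num : 3 ≤ 6) := by
        funext i
        simp [v]
      rw [hve]
      exact this
    refine ⟨Submodule.span K (Set.range v), ?_, ?_⟩
    · rw [finrank_span_eq_card hv]; simp
    · have key : ∀ φ ∈ Submodule.span K (Set.range v), φ (m 3) = 0 ∧ φ (m 4) = 0 ∧ φ (m 5) = 0 := by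
        intro φ hφ
        induction hφ using Submodule.span_induction with
        | mem x hx =>
          obtain ⟨i, rfl⟩ := hx
          simp only [v, hc]
          fin_cases i <;> simp <;> decide
        | zero => simp
        | add x y _ _ hx hy => simp [hx, hy]
        | smul a x _ hx => simp [hx]
      intro φ hφ ψ hψ
      obtain ⟨h3, h4, h5⟩ := key φ hφ
      obtain ⟨g3, g4, g5⟩ := key ψ hψ
      simp [splitForm_apply, h3, h4, h5, g3, g4, g5]

theorem exists_hyperbolic [CharZero K] {V : Type} [AddCommGroup V] [Module K V]
    [FiniteDimensional K V] (hdim : Module.finrank K V = 6)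
    (B : V →ₗ[K] V →ₗ[K] K) (hs : ∀ φ ψ, B φ ψ = B ψ φ)
    (hn : ∀ φ, (∀ ψ, B φ ψ = 0) → φ = 0)
    (W : Submodule K V) (hW : Module.finrank K W = 3) (hiso : ∀ φ ∈ W, ∀ ψ ∈ W, B φ ψ = 0) :
    ∃ f : Basis (Fin 6) K V, ∀ i j, B (f i) (f j) = if j = Fin.rev i then 1 else 0 := by
  have hinj : Function.Injective B := by
    rw [injective_iff_map_eq_zero]
    intro φ h
    exact hn φ fun ψ => by rw [h]; rfl
  have hsurj : Function.Surjective B :=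
    (LinearMap.injective_iff_surjective_of_finrank_eq_finrank
      (Subspace.dual_finrank_eq (K := K) (V := V)).symm).1 hinj
  let w : Basis (Fin 3) K W := Module.finBasisOfFinrankEq K W hW
  have hex : ∀ j : Fin 3, ∃ p : V, ∀ i, B p (w i : V) = if i = j then 1 else 0 := by
    intro j
    obtain ⟨g, hg⟩ := LinearMap.exists_extend (w.coord j)
    obtain ⟨p, hp⟩ := hsurj g
    refine ⟨p, fun i => ?_⟩
    have := LinearMap.congr_fun hg (w i)
    simp only [LinearMap.comp_apply, Submodule.subtype_apply, Basis.coord_apply,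
      Basis.repr_self, Finsupp.single_apply] at this
    rw [hp, this]
  choose p hp using hex
  have hp' : ∀ i j, B (w i : V) (p j) = if i = j then 1 else 0 := fun i j => by rw [hs, hp]
  have hww : ∀ i j, B (w i : V) (w j) = 0 := fun i j => hiso _ (w i).2 _ (w j).2
  let q : Fin 3 → V := fun j => p j - (2⁻¹ : K) • ∑ i, B (p i) (p j) • (w i : V)
  have hqw : ∀ i j, B (q j) (w i : V) = if i = j then 1 else 0 := by
    intro i j
    simp [q, hp, hww]
  have hwq : ∀ i j, B (w i : V) (q j) = if i = j then 1 else 0 := fun i j => by rw [hs, hqw]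
  have hqq : ∀ i j, B (q i) (q j) = 0 := by
    intro i j
    conv_lhs => arg 2; simp only [q]
    simp only [map_sub, map_smul, map_sum, hqw, smul_eq_mul]
    simp only [q, map_sub, map_smul, map_sum, LinearMap.sub_apply, LinearMap.smul_apply,
      LinearMap.sum_apply, hp', smul_eq_mul]
    simp [hs (p j) (p i)]
    ring
  let f : Fin 6 → V := ![w 0, w 1, w 2, q 2, q 1, q 0]
  have hf : ∀ i j, B (f i) (f j) = if j = Fin.rev i then 1 else 0 := by
    intro i j
    fin_cases i <;> fin_cases j <;> simp [f, hww, hqq, hwq, hqw]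
  have hli : LinearIndependent K f := by
    rw [Fintype.linearIndependent_iff]
    intro g hg i
    have := congrArg (fun v => B v (f (Fin.rev i))) hg
    simpa [hf] using this
  refine ⟨basisOfLinearIndependentOfCardEqFinrank hli (by simp [hdim]), fun i j => ?_⟩
  simpa using hf i j

theorem backward [CharZero K] (d : K → K) (hd : IsDeriv d) [FiniteDimensional K M]
    (hdim : Module.finrank K M = 6)
    (D : M → M) (hD : IsDiff d D)
    (B : Module.Dual K M →ₗ[K] Module.Dual K M →ₗ[K] K)
    (hs : ∀ φ ψ, B φ ψ = B ψ φ)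
    (hB : ∀ φ ψ, d (B φ ψ) = B (dualD hd hD φ) ψ + B φ (dualD hd hD ψ))
    (hn : ∀ φ, (∀ ψ, B φ ψ = 0) → φ = 0)
    (W : Submodule K (Module.Dual K M)) (hW : Module.finrank K W = 3)
    (hiso : ∀ φ ∈ W, ∀ ψ ∈ W, B φ ψ = 0) :
    ∃ DN : (Fin 4 → K) → (Fin 4 → K), IsDiff d DN ∧ TraceZero K DN 4 ∧
      ∃ β : (Fin 4 → K) →ₗ[K] (Fin 4 → K) →ₗ[K] M,
        (∀ x, β x x = 0) ∧
        (∀ x y, D (β x y) = β (DN x) y + β x (DN y)) ∧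
        Submodule.span K {m : M | ∃ x y, β x y = m} = ⊤ := by
  obtain ⟨f, hf⟩ := exists_hyperbolic (by rw [Subspace.dual_finrank_eq, hdim]) B hs hn W hW hiso
  let m : Basis (Fin 6) K M := f.dualBasis.map (Module.evalEquiv K M).symm
  have hfm : ∀ i j, f i (m j) = if i = j then 1 else 0 := by
    intro i j
    have : (Module.evalEquiv K M) (m j) = f.dualBasis j := by simp [m]
    have h2 := LinearMap.congr_fun this (f i)
    simpa [Finsupp.single_apply] using h2
  have hext : ∀ u v : M, (∀ k, f k u = f k v) → u = v := by
    intro u v h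
    apply (Module.evalEquiv K M).injective
    apply f.ext
    intro k
    simpa using h k
  let A : Fin 6 → Fin 6 → K := fun j i => f j (D (m i))
  have hdual : ∀ j, dualD hd hD (f j) = - ∑ i, A j i • f i := by
    intro j
    apply m.ext
    intro i
    have : dualD hd hD (f j) (m i) = d (f j (m i)) - f j (D (m i)) := rfl
    rw [this, hfm]
    have h0 : d (if j = i then 1 else 0) = 0 := by
      split_ifs
      · exact done_aux hd
      · exact dzero_aux hd
    rw [h0]
    simp [hfm, A]
  have hso : ∀ j k, A j (Fin.rev k) = - A k (Fin.rev j) := by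
    intro j k
    have h := hB (f j) (f k)
    have h0 : d (B (f j) (f k)) = 0 := by
      rw [hf]
      split_ifs
      · exact done_aux hd
      · exact dzero_aux hd
    rw [h0, hdual, hdual] at h
    have hf2 : ∀ i k, B (f i) (f k) = if i = Fin.rev k then 1 else 0 := fun i k => by
      rw [hs, hf]
    simp only [map_neg, map_sum, map_smul, LinearMap.neg_apply, LinearMap.sum_apply,
      LinearMap.smul_apply, smul_eq_mul] at h
    have e1 : ∑ i, A j i * B (f i) (f k) = A j (Fin.rev k) := by simp [hf2]
    have e2 : ∑ i, A k i * B (f j) (f i) = A k (Fin.rev j) := by simp [hf]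
    rw [e1, e2] at h
    linear_combination h
  have hfD : ∀ k v, f k (D v) = d (f k v) + ∑ i, A k i * f i v := by
    intro k v
    have h : dualD hd hD (f k) v = d (f k v) - f k (D v) := rfl
    rw [hdual] at h
    simp only [LinearMap.neg_apply, LinearMap.sum_apply, LinearMap.smul_apply, smul_eq_mul] at h
    linear_combination h
  let C : Matrix (Fin 4) (Fin 4) K :=
    !![(A 0 0 + A 1 1 + A 2 2) / 2, A 1 3, -A 0 3, A 0 4;
       A 3 1, (A 0 0 - A 1 1 - A 2 2) / 2, A 0 1, A 0 2;
       -A 3 0, A 1 0, (A 1 1 - A 0 0 - A 2 2) / 2, A 1 2;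
       A 4 0, A 2 0, A 2 1, (A 2 2 - A 0 0 - A 1 1) / 2]
  refine ⟨fun x k => d (x k) + (C.mulVec x) k, ⟨?_, ?_⟩, ⟨Pi.basisFun K (Fin 4), C, ?_, ?_⟩,
    wedgeMap m, ?_, ?_, ?_⟩
  · intro x y; funext k
    simp only [Pi.add_apply, hd.1, Matrix.mulVec_add]; ring
  · intro a x; funext k
    simp only [Pi.add_apply, Pi.smul_apply, smul_eq_mul, hd.2, Matrix.mulVec_smul]; ring
  · intro i; funext k
    have h0 : d ((Pi.single i 1 : Fin 4 → K) k) = 0 := by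
      rw [Pi.single_apply]
      split_ifs
      · exact done_aux hd
      · exact dzero_aux hd
    simp only [Pi.basisFun_apply, h0]
    simp [Pi.single_apply]
  · simp only [Matrix.trace, Fin.sum_univ_four, Matrix.diag_apply, C, Matrix.of_apply,
      Matrix.cons_val]
    ring
  · intro x; rw [wedgeMap_apply]; module
  · intro x y
    apply hext
    intro k
    have hw : ∀ (i : Fin 6) (x y : Fin 4 → K), f i (wedgeMap m x y) =
        ![x 0 * y 1 - x 1 * y 0, x 0 * y 2 - x 2 * y 0, x 0 * y 3 - x 3 * y 0,
          x 1 * y 2 - x 2 * y 1, x 3 * y 1 - x 1 * y 3, x 2 * y 3 - x 3 * y 2] i := by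
      intro i x y
      rw [wedgeMap_apply]
      simp only [map_add, map_smul, hfm]
      fin_cases i <;> simp
    rw [hfD, map_add]
    simp only [hw, Fin.sum_univ_six]
    have r00 : A 0 5 = 0 := self_eq_neg.1 (hso 0 0)
    have r01 : A 1 5 = -A 0 4 := hso 1 0
    have r02 : A 2 5 = -A 0 3 := hso 2 0
    have r03 : A 3 5 = -A 0 2 := hso 3 0
    have r04 : A 4 5 = -A 0 1 := hso 4 0
    have r05 : A 5 5 = -A 0 0 := hso 5 0
    have r11 : A 1 4 = 0 := self_eq_neg.1 (hso 1 1)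
    have r12 : A 2 4 = -A 1 3 := hso 2 1
    have r13 : A 3 4 = -A 1 2 := hso 3 1
    have r14 : A 4 4 = -A 1 1 := hso 4 1
    have r15 : A 5 4 = -A 1 0 := hso 5 1
    have r22 : A 2 3 = 0 := self_eq_neg.1 (hso 2 2)
    have r23 : A 3 3 = -A 2 2 := hso 3 2
    have r24 : A 4 3 = -A 2 1 := hso 4 2
    have r25 : A 5 3 = -A 2 0 := hso 5 2
    have r33 : A 3 2 = 0 := self_eq_neg.1 (hso 3 3)
    have r34 : A 4 2 = -A 3 1 := hso 4 3
    have r35 : A 5 2 = -A 3 0 := hso 5 3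
    have r44 : A 4 1 = 0 := self_eq_neg.1 (hso 4 4)
    have r45 : A 5 1 = -A 4 0 := hso 5 4
    have r55 : A 5 0 = 0 := self_eq_neg.1 (hso 5 5)
    simp only [C, Matrix.mulVec, dotProduct, Fin.sum_univ_four, Matrix.of_apply, Matrix.cons_val]
    fin_cases k <;>
      simp only [Fin.zero_eta, Fin.mk_one, Fin.reduceFinMk, Matrix.cons_val, dsub_aux hd, hd.2,
        r00, r01, r02, r03, r04, r05, r11, r12, r13, r14, r15, r22, r23, r24, r25, r33, r34, r35, r44, r45, r55] <;>
      ring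
  · rw [eq_top_iff, ← m.span_eq, Submodule.span_le]
    rintro _ ⟨i, rfl⟩
    have he : ∀ i, ∃ x y : Fin 4 → K, wedgeMap m x y = m i := by
      intro i
      fin_cases i
      · exact ⟨![1,0,0,0], ![0,1,0,0], by simp [wedgeMap_apply]⟩
      · exact ⟨![1,0,0,0], ![0,0,1,0], by simp [wedgeMap_apply]⟩
      · exact ⟨![1,0,0,0], ![0,0,0,1], by simp [wedgeMap_apply]⟩
      · exact ⟨![0,1,0,0], ![0,0,1,0], by simp [wedgeMap_apply]⟩
      · exact ⟨![0,0,0,1], ![0,1,0,0], by simp [wedgeMap_apply]⟩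
      · exact ⟨![0,0,1,0], ![0,0,0,1], by simp [wedgeMap_apply]⟩
    exact Submodule.subset_span (he i)

end Helpers

/-- **Theorem 4.1.** A `6`-dimensional differential module `M` with
`det M = 1` is isomorphic to `Λ² N` for a `4`-dimensional differential module `N`
with `det N = 1` if and only if there is `F ∈ Sym² M` with `∂ F = 0` which, viewed as
a symmetric bilinear form on `M*`, is nondegenerate and admits a totally isotropic
subspace of dimension `3`. -/
theorem stmt3 {K : Type} [Field K] [CharZero K] (d : K → K) (hd : IsDeriv d)
    (M : Type) [AddCommGroup M] [Module K M] [FiniteDimensional K M]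
    (hdim : Module.finrank K M = 6)
    (D : M → M) (hD : IsDiff d D) (hdet : TraceZero K D 6) :
    -- (1) `M ≅ Λ² N` as differential modules, `dim N = 4`, `det N = 1`; the
    -- isomorphism is encoded by an alternating `∂`-compatible bilinear map
    -- `β : N × N → M` whose image spans `M` (hence `Λ²N → M` is onto, so bijective).
    (∃ DN : (Fin 4 → K) → (Fin 4 → K), IsDiff d DN ∧ TraceZero K DN 4 ∧
      ∃ β : (Fin 4 → K) →ₗ[K] (Fin 4 → K) →ₗ[K] M,
        (∀ x, β x x = 0) ∧
        (∀ x y, D (β x y) = β (DN x) y + β x (DN y)) ∧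
        Submodule.span K {m : M | ∃ x y, β x y = m} = ⊤)
    ↔
    -- (2) there is `F ∈ Sym² M` (a symmetric bilinear form `B` on `M*`) with
    -- `∂ F = 0`, nondegenerate, with a totally isotropic subspace of dimension 3.
    (∃ B : Module.Dual K M →ₗ[K] Module.Dual K M →ₗ[K] K,
      (∀ φ ψ, B φ ψ = B ψ φ) ∧
      (∀ φ ψ, d (B φ ψ) = B (dualD hd hD φ) ψ + B φ (dualD hd hD ψ)) ∧
      (∀ φ, (∀ ψ, B φ ψ = 0) → φ = 0) ∧
      ∃ W : Submodule K (Module.Dual K M), Module.finrank K W = 3 ∧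
        ∀ φ ∈ W, ∀ ψ ∈ W, B φ ψ = 0) := by
  constructor
  · rintro ⟨DN, -, htr, β, h1, h2, h3⟩
    exact forward d hd hdim D hD DN htr β h1 h2 h3
  · rintro ⟨B, h1, h2, h3, W, h4, h5⟩
    exact backward d hd hdim D hD B h1 h2 h3 W h4 h5
end

section
/- Let (K,d) be a differential field of characteristic 0 such that every nondegenerate symmetric bilinear form on a K-vector space of dimension at least 3 admits a nonzero isotropic vector. Let (M,∂) be an irreducible differential module over K of dimension 6, and suppose there exists a nonzero F ∈ Sym²M with ∂F = 0. Then there exist a field extension K⁺ ⊇ K of degree at most 2, equipped with a derivation extending d, and a differential module N over K⁺ of dimension 4 with det N = 1, such that K⁺ ⊗_K M (with its induced differential structure) is isomorphic to Λ²N as a differential module over K⁺. -/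
open Module

open scoped TensorProduct

section Helpers

theorem IsDeriv.map_zero {K : Type} [Field K] {d : K → K} (hd : IsDeriv d) : d 0 = 0 := by
  have := hd.1 0 0
  simpa using this

theorem IsDeriv.map_one {K : Type} [Field K] {d : K → K} (hd : IsDeriv d) : d 1 = 0 := by
  have := hd.2 1 1
  simpa using this

theorem IsDeriv.map_neg {K : Type} [Field K] {d : K → K} (hd : IsDeriv d) (a : K) :
    d (-a) = - d a := by
  have := hd.1 a (-a)
  rw [add_neg_cancel, hd.map_zero] at this
  linear_combination -this

theorem IsDeriv.map_sub {K : Type} [Field K] {d : K → K} (hd : IsDeriv d) (a b : K) :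
    d (a - b) = d a - d b := by
  rw [sub_eq_add_neg, hd.1, hd.map_neg, sub_eq_add_neg]

/-- Expansion of a vector in a hyperbolic basis. -/
theorem hyp_expand {L : Type} [Field L] {V : Type} [AddCommGroup V] [Module L V]
    [FiniteDimensional L V] (hdim : Module.finrank L V = 6)
    (b : V →ₗ[L] V →ₗ[L] L) (hs : ∀ x y, b x y = b y x) (e f : Fin 3 → V)
    (hee : ∀ i j, b (e i) (e j) = 0) (hff : ∀ i j, b (f i) (f j) = 0)
    (hef : ∀ i j, b (e i) (f j) = if i = j then 1 else 0) (w : V) :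
    w = ∑ i, (b w (f i) • e i + b w (e i) • f i) := by
  have hfe : ∀ i j, b (f i) (e j) = if i = j then 1 else 0 := by
    intro i j
    rw [hs, hef]
    simp only [eq_comm]
  let T : V →ₗ[L] (Fin 3 → L) × (Fin 3 → L) :=
    LinearMap.prod (LinearMap.pi fun i => b.flip (f i)) (LinearMap.pi fun i => b.flip (e i))
  have hT : Function.Surjective T := by
    rintro ⟨x, y⟩
    refine ⟨∑ i, (x i • e i + y i • f i), ?_⟩
    ext j
    · change b (∑ i, (x i • e i + y i • f i)) (f j) = x j
      simp [hef, hff]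
    · change b (∑ i, (x i • e i + y i • f i)) (e j) = y j
      simp [hfe, hee]
  have hinj : Function.Injective T := by
    rw [LinearMap.injective_iff_surjective_of_finrank_eq_finrank]
    · exact hT
    · simp [hdim]
  apply hinj
  ext j
  · change b w (f j) = b (∑ i, (b w (f i) • e i + b w (e i) • f i)) (f j)
    simp [hef, hff]
  · change b w (e j) = b (∑ i, (b w (f i) • e i + b w (e i) • f i)) (e j)
    simp [hfe, hee]

/-- The map `Λ² L⁴ → V` attached to a hyperbolic basis. -/
def plueckerMap {L : Type} [Field L] {V : Type} [AddCommGroup V] [Module L V]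
    (e f : Fin 3 → V) : (Fin 4 → L) →ₗ[L] (Fin 4 → L) →ₗ[L] V :=
  LinearMap.mk₂ L (fun x y =>
    (x 0 * y 1 - x 1 * y 0) • e 0 + (x 0 * y 2 - x 2 * y 0) • e 1
      + (x 0 * y 3 - x 3 * y 0) • e 2 + (x 2 * y 3 - x 3 * y 2) • f 0
      + (x 3 * y 1 - x 1 * y 3) • f 1 + (x 1 * y 2 - x 2 * y 1) • f 2)
    (by intros; simp only [Pi.add_apply]; module)
    (by intros; simp only [Pi.smul_apply, smul_eq_mul]; module)
    (by intros; simp only [Pi.add_apply]; module)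
    (by intros; simp only [Pi.smul_apply, smul_eq_mul]; module)

theorem plueckerMap_apply {L : Type} [Field L] {V : Type} [AddCommGroup V] [Module L V]
    (e f : Fin 3 → V) (x y : Fin 4 → L) : plueckerMap e f x y =
    (x 0 * y 1 - x 1 * y 0) • e 0 + (x 0 * y 2 - x 2 * y 0) • e 1
      + (x 0 * y 3 - x 3 * y 0) • e 2 + (x 2 * y 3 - x 3 * y 2) • f 0
      + (x 3 * y 1 - x 1 * y 3) • f 1 + (x 1 * y 2 - x 2 * y 1) • f 2 := rfl

set_option maxHeartbeats 1600000 in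
/-- The split case: `so(6) = sl(4)`. -/
theorem split_case {L : Type} [Field L] [CharZero L] {d : L → L} (hd : IsDeriv d)
    {V : Type} [AddCommGroup V] [Module L V]
    [FiniteDimensional L V] (hdim : Module.finrank L V = 6) {D : V → V} (hD : IsDiff d D)
    (b : V →ₗ[L] V →ₗ[L] L) (hs : ∀ x y, b x y = b y x)
    (hb : ∀ x y, d (b x y) = b (D x) y + b x (D y)) (e f : Fin 3 → V)
    (hee : ∀ i j, b (e i) (e j) = 0) (hff : ∀ i j, b (f i) (f j) = 0)
    (hef : ∀ i j, b (e i) (f j) = if i = j then 1 else 0) :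
    ∃ DN : (Fin 4 → L) → (Fin 4 → L), IsDiff d DN ∧ TraceZero L DN 4 ∧
      ∃ β : (Fin 4 → L) →ₗ[L] (Fin 4 → L) →ₗ[L] V,
        (∀ x, β x x = 0) ∧
        (∀ x y, D (β x y) = β (DN x) y + β x (DN y)) ∧
        Submodule.span L {m : V | ∃ x y, β x y = m} = ⊤ := by
  have hexp := hyp_expand hdim b hs e f hee hff hef
  have kee : ∀ i j, b (D (e i)) (e j) = - b (D (e j)) (e i) := by
    intro i j
    have := hb (e i) (e j)
    rw [hee, hd.map_zero, hs (e i)] at this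
    linear_combination -this
  have kff : ∀ i j, b (D (f i)) (f j) = - b (D (f j)) (f i) := by
    intro i j
    have := hb (f i) (f j)
    rw [hff, hd.map_zero, hs (f i)] at this
    linear_combination -this
  have kfe : ∀ i j, b (D (f i)) (e j) = - b (D (e j)) (f i) := by
    intro i j
    have := hb (f i) (e j)
    have h0 : d (b (f i) (e j)) = 0 := by
      rw [hs, hef]
      split_ifs
      · exact hd.map_one
      · exact hd.map_zero
    rw [h0, hs (f i)] at this
    linear_combination -this
  have kee0 : ∀ i, b (D (e i)) (e i) = 0 := fun i => by
    have := kee i i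
    rwa [eq_neg_iff_add_eq_zero, ← two_mul, mul_eq_zero, or_iff_right two_ne_zero] at this
  have kff0 : ∀ i, b (D (f i)) (f i) = 0 := fun i => by
    have := kff i i
    rwa [eq_neg_iff_add_eq_zero, ← two_mul, mul_eq_zero, or_iff_right two_ne_zero] at this
  let p := b (D (e 0)) (f 0)
  let q := b (D (e 1)) (f 1)
  let r := b (D (e 2)) (f 2)
  let X : Matrix (Fin 4) (Fin 4) L :=
    !![(p + q + r) / 2, - b (D (f 1)) (f 2), b (D (f 0)) (f 2), - b (D (f 0)) (f 1);
       b (D (e 1)) (e 2), p - (p + q + r) / 2, b (D (e 1)) (f 0), b (D (e 2)) (f 0);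
       - b (D (e 0)) (e 2), b (D (e 0)) (f 1), q - (p + q + r) / 2, b (D (e 2)) (f 1);
       b (D (e 0)) (e 1), b (D (e 0)) (f 2), b (D (e 1)) (f 2), r - (p + q + r) / 2]
  refine ⟨fun x i => d (x i) + (X.mulVec x) i, ⟨?_, ?_⟩, ⟨Pi.basisFun L (Fin 4), X, ?_, ?_⟩,
    plueckerMap e f, ?_, ?_, ?_⟩
  · intro x y
    ext i
    simp only [Pi.add_apply, hd.1, Matrix.mulVec_add]
    ring
  · intro a x
    ext i
    simp only [Pi.add_apply, Pi.smul_apply, smul_eq_mul, hd.2, Matrix.mulVec_smul]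
    ring
  · intro i
    ext j
    have : d ((Pi.single i (1 : L) : Fin 4 → L) j) = 0 := by
      rw [Pi.single_apply]
      split_ifs
      · exact hd.map_one
      · exact hd.map_zero
    simp [this]
    simp [Pi.single_apply]
  · simp [X, Matrix.trace, Fin.sum_univ_four]
    ring
  · intro x
    rw [plueckerMap_apply]
    module
  · intro x y
    have he := fun i => hexp (D (e i))
    have hf := fun i => hexp (D (f i))
    simp only [Fin.sum_univ_three] at he hf
    have h0 := he 0
    have h1 := he 1
    have h2 := he 2
    have g0 := hf 0
    have g1 := hf 1
    have g2 := hf 2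
    simp only [kfe, kee0, kff0] at h0 h1 h2 g0 g1 g2
    rw [kee 1 0] at h1
    rw [kee 2 0, kee 2 1] at h2
    rw [kff 1 0] at g1
    rw [kff 2 0, kff 2 1] at g2
    have X0 : ∀ z : Fin 4 → L, (X.mulVec z) 0 = (p + q + r) / 2 * z 0 + - b (D (f 1)) (f 2) * z 1
        + b (D (f 0)) (f 2) * z 2 + - b (D (f 0)) (f 1) * z 3 := by
      intro z; simp [X, Matrix.mulVec, dotProduct, Fin.sum_univ_four]
    have X1 : ∀ z : Fin 4 → L, (X.mulVec z) 1 = b (D (e 1)) (e 2) * z 0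
        + (p - (p + q + r) / 2) * z 1 + b (D (e 1)) (f 0) * z 2 + b (D (e 2)) (f 0) * z 3 := by
      intro z; simp [X, Matrix.mulVec, dotProduct, Fin.sum_univ_four]
    have X2 : ∀ z : Fin 4 → L, (X.mulVec z) 2 = - b (D (e 0)) (e 2) * z 0
        + b (D (e 0)) (f 1) * z 1 + (q - (p + q + r) / 2) * z 2 + b (D (e 2)) (f 1) * z 3 := by
      intro z; simp [X, Matrix.mulVec, dotProduct, Fin.sum_univ_four]
    have X3 : ∀ z : Fin 4 → L, (X.mulVec z) 3 = b (D (e 0)) (e 1) * z 0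
        + b (D (e 0)) (f 2) * z 1 + b (D (e 1)) (f 2) * z 2 + (r - (p + q + r) / 2) * z 3 := by
      intro z; simp [X, Matrix.mulVec, dotProduct, Fin.sum_univ_four]
    simp only [plueckerMap_apply, hD.1, hD.2, hd.2, hd.map_sub]
    rw [h0, h1, h2, g0, g1, g2]
    simp only [X0, X1, X2, X3, p, q, r]
    module
  · rw [eq_top_iff]
    intro w _
    have hmem : ∀ x y, plueckerMap e f x y ∈
        Submodule.span L {m : V | ∃ x y, plueckerMap (L := L) e f x y = m} :=
      fun x y => Submodule.subset_span ⟨x, y, rfl⟩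
    have m0 := hmem ![1, 0, 0, 0] ![0, 1, 0, 0]
    have m1 := hmem ![1, 0, 0, 0] ![0, 0, 1, 0]
    have m2 := hmem ![1, 0, 0, 0] ![0, 0, 0, 1]
    have n0 := hmem ![0, 0, 1, 0] ![0, 0, 0, 1]
    have n1 := hmem ![0, 0, 0, 1] ![0, 1, 0, 0]
    have n2 := hmem ![0, 1, 0, 0] ![0, 0, 1, 0]
    generalize Submodule.span L {m : V | ∃ x y, plueckerMap (L := L) e f x y = m} = S at *
    simp [plueckerMap_apply] at m0 m1 m2 n0 n1 n2
    rw [hexp w, Fin.sum_univ_three]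
    exact S.add_mem (S.add_mem
      (S.add_mem (S.smul_mem _ m0) (S.smul_mem _ n0))
      (S.add_mem (S.smul_mem _ m1) (S.smul_mem _ n1)))
      (S.add_mem (S.smul_mem _ m2) (S.smul_mem _ n2))

/-- Splitting off a hyperbolic plane. -/
theorem split_plane {K : Type} [Field K] [CharZero K]
    (hK : ∀ n : ℕ, 3 ≤ n → ∀ B : (Fin n → K) →ₗ[K] (Fin n → K) →ₗ[K] K,
      (∀ x y, B x y = B y x) → (∀ x, (∀ y, B x y = 0) → x = 0) →
      ∃ x, x ≠ 0 ∧ B x x = 0)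
    {V : Type} [AddCommGroup V] [Module K V] [FiniteDimensional K V] (n : ℕ) (hn : 1 ≤ n)
    (hdim : Module.finrank K V = n + 2)
    (b : V →ₗ[K] V →ₗ[K] K) (hs : ∀ x y, b x y = b y x)
    (hnd : ∀ x, (∀ y, b x y = 0) → x = 0) :
    ∃ (e f : V) (W : Submodule K V), b e e = 0 ∧ b f f = 0 ∧ b e f = 1 ∧
      Module.finrank K W = n ∧ (∀ w ∈ W, b e w = 0 ∧ b f w = 0) ∧
      (∀ x ∈ W, (∀ y ∈ W, b x y = 0) → x = 0) := by
  -- an isotropic vector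
  obtain ⟨e, he0, hee⟩ : ∃ e : V, e ≠ 0 ∧ b e e = 0 := by
    let φ : V ≃ₗ[K] (Fin (n + 2) → K) := (finBasisOfFinrankEq K V hdim).equivFun
    obtain ⟨x, hx0, hx⟩ := hK (n + 2) (by omega)
      (b.compl₁₂ φ.symm.toLinearMap φ.symm.toLinearMap)
      (by intro x y; simp [hs (φ.symm x)])
      (by
        intro x hx
        have : φ.symm x = 0 := by
          apply hnd
          intro y
          simpa using hx (φ y)
        simpa using this)
    exact ⟨φ.symm x, by simpa using hx0, by simpa using hx⟩
  obtain ⟨g, hg⟩ : ∃ g, b e g ≠ 0 := by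
    by_contra! h
    exact he0 (hnd e h)
  -- a partner
  obtain ⟨f, hff, hef⟩ : ∃ f, b f f = 0 ∧ b e f = 1 := by
    refine ⟨(b e g)⁻¹ • g - (b g g / (2 * (b e g) ^ 2)) • e, ?_, ?_⟩
    · simp only [map_sub, map_smul, LinearMap.sub_apply, LinearMap.smul_apply, smul_eq_mul, hee,
        hs g e]
      field_simp
      ring
    · simp only [map_sub, map_smul, smul_eq_mul, hee]
      field_simp
      ring
  have hfe : b f e = 1 := by rw [hs, hef]
  let T : V →ₗ[K] K × K := LinearMap.prod (b e) (b f)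
  have hT : ∀ x, T x = (b e x, b f x) := fun x => rfl
  have hTs : Function.Surjective T := by
    rintro ⟨x, y⟩
    refine ⟨x • f + y • e, ?_⟩
    simp [hT, hee, hff, hef, hfe]
  refine ⟨e, f, LinearMap.ker T, hee, hff, hef, ?_, ?_, ?_⟩
  · have h1 := T.finrank_range_add_finrank_ker
    rw [LinearMap.range_eq_top.2 hTs, finrank_top, hdim] at h1
    simp at h1
    omega
  · intro w hw
    rw [LinearMap.mem_ker, hT, Prod.mk_eq_zero] at hw
    exact hw
  · intro x hx hxy
    rw [LinearMap.mem_ker, hT, Prod.mk_eq_zero] at hx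
    apply hnd
    intro y
    have h := hxy (y - b f y • e - b e y • f) (by
      rw [LinearMap.mem_ker, hT, Prod.mk_eq_zero]
      simp [hee, hff, hef, hfe])
    simpa [hs x e, hs x f, hx.1, hx.2] using h

/-- Diagonalising a binary form. -/
theorem diag_plane {K : Type} [Field K] [CharZero K]
    {V : Type} [AddCommGroup V] [Module K V] [FiniteDimensional K V]
    (hdim : Module.finrank K V = 2)
    (b : V →ₗ[K] V →ₗ[K] K) (hs : ∀ x y, b x y = b y x)
    (hnd : ∀ x, (∀ y, b x y = 0) → x = 0) :
    ∃ u v : V, b u u ≠ 0 ∧ b v v ≠ 0 ∧ b u v = 0 := by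
  haveI : Nontrivial V := Module.nontrivial_of_finrank_pos (R := K) (by omega)
  obtain ⟨u, hu⟩ : ∃ u, b u u ≠ 0 := by
    by_contra! h
    obtain ⟨x, hx⟩ := exists_ne (0 : V)
    apply hx
    apply hnd
    intro y
    have h1 := h (x + y)
    simp only [map_add, LinearMap.add_apply, h, hs y x] at h1
    have : (2 : K) * b x y = 0 := by linear_combination h1
    simpa using this
  have hdec : ∀ x, b u (x - (b u x / b u u) • u) = 0 := by
    intro x
    simp [hu]
  refine ⟨u, ?_⟩
  by_contra! hcon
  -- every vector orthogonal to `u` is isotropic, so the orthogonal complement is totally isotropic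
  have hiso : ∀ v, b u v = 0 → b v v = 0 := by
    intro v hv
    by_contra h
    exact hcon v hu h hv
  have hz : ∀ v, b u v = 0 → v = 0 := by
    intro v hv
    apply hnd
    intro y
    have h1 := hdec y
    have h2 := hiso (v + (y - (b u y / b u u) • u)) (by rw [map_add, hv, h1, add_zero])
    have h3 := hiso _ h1
    have h4 := hiso _ hv
    generalize hw : y - (b u y / b u u) • u = w at *
    have hy : y = w + (b u y / b u u) • u := by rw [← hw]; abel
    simp only [map_add, LinearMap.add_apply, h3, h4, hs w v] at h2
    have h5 : b v w = 0 := by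
      have : (2 : K) * b v w = 0 := by linear_combination h2
      simpa using this
    rw [hy, map_add, h5, map_smul, hs v u, hv]
    simp
  have := LinearMap.finrank_le_finrank_of_injective (f := b u)
    ((injective_iff_map_eq_zero _).2 hz)
  rw [hdim] at this
  simp at this

theorem decompose {K : Type} [Field K] [CharZero K]
    (hK : ∀ n : ℕ, 3 ≤ n → ∀ B : (Fin n → K) →ₗ[K] (Fin n → K) →ₗ[K] K,
      (∀ x y, B x y = B y x) → (∀ x, (∀ y, B x y = 0) → x = 0) →
      ∃ x, x ≠ 0 ∧ B x x = 0)
    {V : Type} [AddCommGroup V] [Module K V] [FiniteDimensional K V]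
    (hdim : Module.finrank K V = 6)
    (b : V →ₗ[K] V →ₗ[K] K) (hs : ∀ x y, b x y = b y x)
    (hnd : ∀ x, (∀ y, b x y = 0) → x = 0) :
    ∃ e₁ f₁ e₂ f₂ u v : V, (b e₁ e₁ = 0 ∧ b f₁ f₁ = 0 ∧ b e₁ f₁ = 1) ∧
      (b e₂ e₂ = 0 ∧ b f₂ f₂ = 0 ∧ b e₂ f₂ = 1) ∧
      (b u u ≠ 0 ∧ b v v ≠ 0 ∧ b u v = 0) ∧
      (b e₁ e₂ = 0 ∧ b e₁ f₂ = 0 ∧ b e₁ u = 0 ∧ b e₁ v = 0) ∧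
      (b f₁ e₂ = 0 ∧ b f₁ f₂ = 0 ∧ b f₁ u = 0 ∧ b f₁ v = 0) ∧
      (b e₂ u = 0 ∧ b e₂ v = 0 ∧ b f₂ u = 0 ∧ b f₂ v = 0) := by
  obtain ⟨e₁, f₁, W, h1, h2, h3, hW, hWo, hWn⟩ := split_plane hK 4 (by norm_num) hdim b hs hnd
  obtain ⟨e₂, f₂, U, k1, k2, k3, hU, hUo, hUn⟩ := split_plane hK 2 (by norm_num) hW
    (b.domRestrict₁₂ W W) (fun x y => hs x y)
    (fun x hx => Subtype.ext (hWn x x.2 fun y hy => hx ⟨y, hy⟩))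
  obtain ⟨u, v, l1, l2, l3⟩ := diag_plane hU
    ((b.domRestrict₁₂ W W).domRestrict₁₂ U U) (fun x y => hs x y)
    (fun x hx => Subtype.ext (hUn x x.2 fun y hy => hx ⟨y, hy⟩))
  exact ⟨e₁, f₁, e₂, f₂, u, v, ⟨h1, h2, h3⟩, ⟨k1, k2, k3⟩, ⟨l1, l2, l3⟩,
    ⟨(hWo _ e₂.2).1, (hWo _ f₂.2).1, (hWo _ u.1.2).1, (hWo _ v.1.2).1⟩,
    ⟨(hWo _ e₂.2).2, (hWo _ f₂.2).2, (hWo _ u.1.2).2, (hWo _ v.1.2).2⟩,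
    ⟨(hUo _ u.2).1, (hUo _ v.2).1, (hUo _ u.2).2, (hUo _ v.2).2⟩⟩

/-- The invariant form on `M`. -/
theorem exists_form {K : Type} [Field K] {d : K → K} (hd : IsDeriv d)
    {M : Type} [AddCommGroup M] [Module K M] [FiniteDimensional K M]
    {D : M → M} (hD : IsDiff d D) (hirr : IsIrr K D)
    (B : Module.Dual K M →ₗ[K] Module.Dual K M →ₗ[K] K) (hB0 : B ≠ 0)
    (hsym : ∀ φ ψ, B φ ψ = B ψ φ)
    (hconst : ∀ φ ψ, d (B φ ψ) = B (dualD hd hD φ) ψ + B φ (dualD hd hD ψ)) :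
    ∃ b : M →ₗ[K] M →ₗ[K] K, (∀ x y, b x y = b y x) ∧ (∀ x, (∀ y, b x y = 0) → x = 0) ∧
      ∀ x y, d (b x y) = b (D x) y + b x (D y) := by
  let ℓ : Module.Dual K M →ₗ[K] M := (Module.evalEquiv K M).symm.toLinearMap ∘ₗ B
  have hℓ : ∀ φ ψ, ψ (ℓ φ) = B φ ψ := by
    intro φ ψ
    simp [ℓ]
  have hℓD : ∀ φ, D (ℓ φ) = ℓ (dualD hd hD φ) := by
    intro φ
    rw [← sub_eq_zero, ← Module.forall_dual_apply_eq_zero_iff K]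
    intro ψ
    have h1 := hconst φ ψ
    have h2 : dualD hd hD ψ (ℓ φ) = d (ψ (ℓ φ)) - ψ (D (ℓ φ)) := rfl
    rw [hℓ, hℓ] at h2
    rw [map_sub, hℓ]
    linear_combination h2 + h1
  have hsurj : Function.Surjective ℓ := by
    rw [← LinearMap.range_eq_top]
    refine (hirr.2 (LinearMap.range ℓ) ?_).resolve_left ?_
    · rintro _ ⟨φ, rfl⟩
      exact ⟨_, (hℓD φ).symm⟩
    · intro h
      rw [LinearMap.range_eq_bot] at h
      apply hB0
      ext φ ψ
      rw [← hℓ, h]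
      simp
  have hinj : Function.Injective ℓ :=
    (LinearMap.injective_iff_surjective_of_finrank_eq_finrank Subspace.dual_finrank_eq).2 hsurj
  let E : Module.Dual K M ≃ₗ[K] M := LinearEquiv.ofBijective ℓ ⟨hinj, hsurj⟩
  have hE : ∀ φ, E φ = ℓ φ := fun φ => rfl
  refine ⟨B.compl₁₂ E.symm.toLinearMap E.symm.toLinearMap, ?_, ?_, ?_⟩
  · intro x y
    simp [hsym (E.symm x)]
  · intro x hx
    have : E.symm x = 0 := by
      apply hinj
      rw [map_zero, ← Module.forall_dual_apply_eq_zero_iff K]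
      intro ψ
      rw [hℓ]
      simpa using hx (E ψ)
    simpa using this
  · intro x y
    obtain ⟨φ, rfl⟩ := E.surjective x
    obtain ⟨ψ, rfl⟩ := E.surjective y
    have h1 : ∀ χ, E.symm (D (E χ)) = dualD hd hD χ := by
      intro χ
      rw [LinearEquiv.symm_apply_eq, hE, hE, hℓD]
    simp [h1, hconst]

/-- Adjoining a square root in a differential field. -/
theorem exists_ext {K : Type} [Field K] [CharZero K] {d : K → K} (hd : IsDeriv d) (δ : K) :
    ∃ (K' : Type) (_ : Field K') (_ : Algebra K K'),
      FiniteDimensional K K' ∧ Module.finrank K K' ≤ 2 ∧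
      (∃ d' : K' → K', IsDeriv d' ∧
        (∀ a : K, d' (algebraMap K K' a) = algebraMap K K' (d a))) ∧
      ∃ s : K', s * s = algebraMap K K' δ := by
  obtain ⟨s, hs⟩ := IsAlgClosed.exists_pow_nat_eq
    (algebraMap K (AlgebraicClosure K) δ) (n := 2) (by norm_num)
  have hint : IsIntegral K s := Algebra.IsIntegral.isIntegral s
  have hfd : FiniteDimensional K (IntermediateField.adjoin K {s}) :=
    IntermediateField.adjoin.finiteDimensional hint
  refine ⟨IntermediateField.adjoin K {s}, inferInstance, inferInstance, hfd, ?_, ?_,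
    ⟨s, IntermediateField.mem_adjoin_simple_self K s⟩, ?_⟩
  · rw [IntermediateField.adjoin.finrank hint]
    have hdvd : minpoly K s ∣ (Polynomial.X ^ 2 - Polynomial.C δ) := by
      apply minpoly.dvd
      simp [hs]
    have := Polynomial.natDegree_le_of_dvd hdvd
      (Polynomial.X_pow_sub_C_ne_zero (by norm_num) δ)
    rwa [Polynomial.natDegree_X_pow_sub_C] at this
  · letI iK : Differential K := ⟨Derivation.mk'
      (AddMonoidHom.toIntLinearMap ⟨⟨d, hd.map_zero⟩, hd.1⟩) (by
        intro a b
        change d (a * b) = a * d b + b * d a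
        rw [hd.2]; ring)⟩
    letI iL : Differential (IntermediateField.adjoin K {s}) :=
      Differential.differentialFiniteDimensional K (IntermediateField.adjoin K {s})
    haveI : DifferentialAlgebra K (IntermediateField.adjoin K {s}) :=
      Differential.differentialAlgebraFiniteDimensional
    refine ⟨fun x => Differential.deriv x, ⟨fun a b => map_add _ a b, ?_⟩, ?_⟩
    · intro a b
      simp only [Derivation.leibniz, smul_eq_mul]
      ring
    · intro a
      exact DifferentialAlgebra.deriv_algebraMap a
  · apply Subtype.ext
    simp [← pow_two, hs]

/-- The induced differential structure on a base change. -/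
theorem exists_baseChange {K : Type} [Field K] {d : K → K}
    {K' : Type} [Field K'] [Algebra K K'] {d' : K' → K'} (hd' : IsDeriv d')
    (hdd : ∀ a : K, d' (algebraMap K K' a) = algebraMap K K' (d a))
    {M : Type} [AddCommGroup M] [Module K M] {D : M → M} (hD : IsDiff d D) :
    ∃ DM : (K' ⊗[K] M) → (K' ⊗[K] M), IsDiff d' DM ∧
      (∀ (a : K') (m : M), DM (a ⊗ₜ[K] m) = d' a ⊗ₜ[K] m + a ⊗ₜ[K] D m) := by
  have hD0 : D 0 = 0 := by simpa using hD.1 0 0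
  let g : K' →+ M →+ K' ⊗[K] M := AddMonoidHom.mk'
    (fun a => AddMonoidHom.mk' (fun m => d' a ⊗ₜ[K] m + a ⊗ₜ[K] D m) (by
      intro x y
      simp only [hD.1, TensorProduct.tmul_add]
      abel)) (by
    intro a b
    ext m
    simp only [AddMonoidHom.mk'_apply, AddMonoidHom.add_apply, hd'.1, TensorProduct.add_tmul]
    abel)
  have hg : ∀ a m, g a m = d' a ⊗ₜ[K] m + a ⊗ₜ[K] D m := fun a m => rfl
  let DM : K' ⊗[K] M →+ K' ⊗[K] M := TensorProduct.liftAddHom g (by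
    intro r a m
    rw [hg, hg, Algebra.smul_def, hd'.2, hdd, hD.2, TensorProduct.add_tmul,
      TensorProduct.tmul_add, ← Algebra.smul_def, ← Algebra.smul_def, ← Algebra.smul_def]
    simp only [TensorProduct.smul_tmul, TensorProduct.tmul_smul]
    abel)
  have hDM : ∀ a m, DM (a ⊗ₜ[K] m) = d' a ⊗ₜ[K] m + a ⊗ₜ[K] D m := fun a m => rfl
  refine ⟨DM, ⟨fun x y => map_add DM x y, ?_⟩, hDM⟩
  intro c x
  induction x with
  | zero => simp
  | add x y hx hy =>
    rw [smul_add, map_add, map_add, hx, hy]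
    simp only [smul_add]
    abel
  | tmul a m =>
    rw [TensorProduct.smul_tmul', smul_eq_mul, hDM, hDM, hd'.2]
    simp only [smul_add, TensorProduct.smul_tmul', smul_eq_mul, TensorProduct.add_tmul]
    abel

end Helpers

/-- **Corollary 4.2.** Over a differential field `K` in which every
nondegenerate symmetric bilinear form in at least `3` variables has a nontrivial
zero: if `M` is an irreducible `6`-dimensional differential module admitting a
nonzero `F ∈ Sym² M` with `∂ F = 0`, then after an extension `K⁺ ⊇ K` of degree at
most `2` (with its derivation extending `d`), `K⁺ ⊗ M ≅ Λ² N` for a differential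
module `N` over `K⁺` of dimension `4` with `det N = 1`. -/
theorem stmt4 {K : Type} [Field K] [CharZero K] (d : K → K) (hd : IsDeriv d)
    -- every nondegenerate symmetric bilinear form on a K-vector space of
    -- dimension at least 3 admits a nonzero isotropic vector
    (hK : ∀ n : ℕ, 3 ≤ n → ∀ B : (Fin n → K) →ₗ[K] (Fin n → K) →ₗ[K] K,
      (∀ x y, B x y = B y x) → (∀ x, (∀ y, B x y = 0) → x = 0) →
      ∃ x, x ≠ 0 ∧ B x x = 0)
    (M : Type) [AddCommGroup M] [Module K M] [FiniteDimensional K M]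
    (hdim : Module.finrank K M = 6)
    (D : M → M) (hD : IsDiff d D) (hirr : IsIrr K D)
    -- a nonzero `F ∈ Sym² M` with `∂ F = 0`, viewed as a symmetric bilinear form on `M*`
    (B : Module.Dual K M →ₗ[K] Module.Dual K M →ₗ[K] K) (hB0 : B ≠ 0)
    (hsym : ∀ φ ψ, B φ ψ = B ψ φ)
    (hconst : ∀ φ ψ, d (B φ ψ) = B (dualD hd hD φ) ψ + B φ (dualD hd hD ψ)) :
    -- there is a field extension `K⁺ ⊇ K` of degree ≤ 2 ...
    ∃ (K' : Type) (_ : Field K') (_ : Algebra K K'),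
      FiniteDimensional K K' ∧ Module.finrank K K' ≤ 2 ∧
      -- ... with a derivation `d'` extending `d` ...
      ∃ d' : K' → K', IsDeriv d' ∧
        (∀ a : K, d' (algebraMap K K' a) = algebraMap K K' (d a)) ∧
        -- ... and the induced differential structure `DM` on `K⁺ ⊗ M` ...
        ∃ DM : (K' ⊗[K] M) → (K' ⊗[K] M), IsDiff d' DM ∧
          (∀ (a : K') (m : M), DM (a ⊗ₜ[K] m) = d' a ⊗ₜ[K] m + a ⊗ₜ[K] D m) ∧
          -- ... and a differential module `N` over `K⁺` of dim 4 with `det N = 1`,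
          -- together with an isomorphism `Λ² N ≅ K⁺ ⊗ M` of differential modules,
          -- encoded by an alternating `∂`-compatible spanning bilinear map.
          ∃ DN : (Fin 4 → K') → (Fin 4 → K'), IsDiff d' DN ∧ TraceZero K' DN 4 ∧
            ∃ β : (Fin 4 → K') →ₗ[K'] (Fin 4 → K') →ₗ[K'] (K' ⊗[K] M),
              (∀ x, β x x = 0) ∧
              (∀ x y, DM (β x y) = β (DN x) y + β x (DN y)) ∧
              Submodule.span K' {m : K' ⊗[K] M | ∃ x y, β x y = m} = ⊤ := by
  obtain ⟨b, hs, hnd, hbD⟩ := exists_form hd hD hirr B hB0 hsym hconst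
  obtain ⟨e₁, f₁, e₂, f₂, u, v, ⟨h1, h2, h3⟩, ⟨h4, h5, h6⟩, ⟨hu, hv, h7⟩, ⟨h8, h9, h10, h11⟩,
    ⟨h12, h13, h14, h15⟩, ⟨h16, h17, h18, h19⟩⟩ := decompose hK hdim b hs hnd
  obtain ⟨K', iF, iA, hfd, hfr, ⟨d', hd', hdd⟩, s, hss⟩ := exists_ext hd (-(b v v / b u u))
  obtain ⟨DM, hDM, hDMt⟩ := exists_baseChange (K' := K') hd' hdd hD
  refine ⟨K', iF, iA, hfd, hfr, d', hd', hdd, DM, hDM, hDMt, ?_⟩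
  haveI : CharZero K' := charZero_of_injective_algebraMap (algebraMap K K').injective
  let b' : (K' ⊗[K] M) →ₗ[K'] (K' ⊗[K] M) →ₗ[K'] K' := LinearMap.BilinForm.baseChange K' b
  have hb' : ∀ a m a' m', b' (a ⊗ₜ[K] m) (a' ⊗ₜ[K] m') = algebraMap K K' (b m m') * (a * a') := by
    intro a m a' m'
    rw [← Algebra.smul_def]
    exact LinearMap.BilinForm.baseChange_tmul ..
  have hs' : ∀ x y, b' x y = b' y x := by
    intro x y
    induction x with
    | zero => simp
    | add x x' hx hx' => simp [hx, hx']
    | tmul a m =>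
      induction y with
      | zero => simp
      | add y y' hy hy' => simp [hy, hy']
      | tmul a' m' => rw [hb', hb', hs m m', mul_comm a a']
  have hDM0 : DM 0 = 0 := by simpa using hDM.1 0 0
  have hbD' : ∀ x y, d' (b' x y) = b' (DM x) y + b' x (DM y) := by
    intro x y
    induction x with
    | zero => simp [hd'.map_zero, hDM0]
    | add x x' hx hx' =>
      simp only [map_add, LinearMap.add_apply, hd'.1, hDM.1, hx, hx']
      ring
    | tmul a m =>
      induction y with
      | zero => simp [hd'.map_zero, hDM0]
      | add y y' hy hy' =>
        simp only [map_add, hd'.1, hDM.1, hy, hy']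
        ring
      | tmul a' m' =>
        simp only [hDMt, map_add, LinearMap.add_apply, hb', hd'.2, hdd, hbD]
        ring
  have hdim' : Module.finrank K' (K' ⊗[K] M) = 6 := by
    rw [Module.finrank_baseChange, hdim]
  have hu' : algebraMap K K' (b u u) ≠ 0 := by simpa using hu
  have hv' : algebraMap K K' (b v v) ≠ 0 := by simpa using hv
  have hss' : algebraMap K K' (b u u) * (s * s) = - algebraMap K K' (b v v) := by
    rw [hss, ← map_mul, ← map_neg]
    congr 1
    field_simp
  let c : K' := (2 * algebraMap K K' (b v v))⁻¹
  have hc : 2 * algebraMap K K' (b v v) * c = 1 := mul_inv_cancel₀ (by simpa using hv)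
  let e : Fin 3 → K' ⊗[K] M := ![1 ⊗ₜ e₁, 1 ⊗ₜ e₂, 1 ⊗ₜ v + s ⊗ₜ u]
  let f : Fin 3 → K' ⊗[K] M := ![1 ⊗ₜ f₁, 1 ⊗ₜ f₂, c • (1 ⊗ₜ v - s ⊗ₜ u)]
  have hall : (∀ i j, b' (e i) (e j) = 0) ∧ (∀ i j, b' (f i) (f j) = 0) ∧
      (∀ i j, b' (e i) (f j) = if i = j then 1 else 0) := by
    refine ⟨?_, ?_, ?_⟩ <;> intro i j <;> fin_cases i <;> fin_cases j <;>
      simp [e, f, hb', h1, h2, h3, h4, h5, h6, h7, h8, h9, h10, h11, h12, h13, h14, h15,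
        h16, h17, h18, h19, hs e₂ e₁, hs f₂ f₁, hs e₂ f₁, hs u e₁, hs v e₁, hs u e₂, hs v e₂,
        hs u f₁, hs v f₁, hs u f₂, hs v f₂, hs v u, hss']
    linear_combination hc
  exact split_case hd' hdim' hDM b' hs' hbD' e f hall.1 hall.2.1 hall.2.2
end
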